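/- Let X be a scheme whose underlying topological space is Noetherian and of finite Krull dimension, and let Y → X be a morphism of schemes of finite type. Then the underlying topological space of Y is Noetherian (and of finite dimension). -/

import Mathlib

open AlgebraicGeometry CategoryTheory TopologicalSpace

open Polynomial in
/-- Let `I` be an ideal of `R[X]` and `N` an ideal of `R` with `N[X] ≤ I`. Among the polynomials
of `I` outside `N[X]`, one of minimal degree cuts out `I` over the locus where all of `N` vanishes
and its leading coefficient does not. -/
theorem Polynomial.exists_leadingCoeff_notMem_forall_mem_of_mem {R : Type*} [CommRing R]
    {N : Ideal R} {I : Ideal R[X]} (hNI : N.map C ≤ I) (hIN : ¬ I ≤ N.map C) :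
    ∃ f ∈ I, f.leadingCoeff ∉ N ∧ ∀ P : Ideal R[X], P.IsPrime → N.map C ≤ P → f ∈ P →
      C f.leadingCoeff ∉ P → I ≤ P := by
  obtain ⟨f₀, hf₀I, hf₀N⟩ := SetLike.not_le_iff_exists.mp hIN
  obtain ⟨f, ⟨hfI, hfN⟩, hmin⟩ := exists_minimalFor_of_wellFoundedLT
    (fun g : R[X] ↦ g ∈ I ∧ g ∉ N.map C) natDegree ⟨f₀, hf₀I, hf₀N⟩
  have hmin' {g : R[X]} (hg : g ∈ I) (hgN : g ∉ N.map C) : f.natDegree ≤ g.natDegree :=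
    le_of_not_gt fun h ↦ (hmin ⟨hg, hgN⟩ h.le).not_gt h
  refine ⟨f, hfI, fun hlc ↦ ?_, fun P hP hNP hfP hlcP ↦ ?_⟩
  · have hmon : monomial f.natDegree f.leadingCoeff ∈ N.map C := by
      rw [← C_mul_X_pow_eq_monomial]
      exact Ideal.mul_mem_right _ _ (Ideal.mem_map_of_mem _ hlc)
    have hsum := f.eraseLead_add_monomial_natDegree_leadingCoeff
    have herase : f.eraseLead ∉ N.map C := fun h ↦ hfN (hsum ▸ add_mem h hmon)
    have heraseI : f.eraseLead ∈ I := by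
      rw [← f.self_sub_monomial_natDegree_leadingCoeff]
      exact sub_mem hfI (hNI hmon)
    rcases f.eraseLead_natDegree_lt_or_eraseLead_eq_zero with h | h
    · exact (hmin' heraseI herase).not_gt h
    · exact herase (h ▸ zero_mem _)
  · intro g hg
    induction h : g.natDegree using Nat.strong_induction_on generalizing g with
    | _ n ih =>
      subst h
      by_cases hgN : g ∈ N.map C
      · exact hNP hgN
      have hle := hmin' hg hgN
      have hcancel : f.cancelLeads g ∈ P := by
        rcases Nat.eq_zero_or_pos g.natDegree with h0 | hpos
        · have hf0 : f.natDegree = 0 := by omega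
          have : f.cancelLeads g = 0 := by
            rw [eq_C_of_natDegree_eq_zero h0, eq_C_of_natDegree_eq_zero hf0]
            simp [cancelLeads, mul_comm]
          exact this ▸ zero_mem _
        · exact ih _ (natDegree_cancelLeads_lt_of_natDegree_le_natDegree hle hpos)
            (sub_mem (I.mul_mem_left _ hg) (I.mul_mem_left _ hfI)) rfl
      have hmul : C f.leadingCoeff * g ∈ P := by
        have := add_mem hcancel
          (P.mul_mem_left (C g.leadingCoeff * X ^ (g.natDegree - f.natDegree)) hfP)
        simpa [cancelLeads, Nat.sub_eq_zero_of_le hle] using this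
      exact (hP.mem_or_mem hmul).resolve_left hlcP

open Polynomial PrimeSpectrum in
/-- Noetherianity of the spectrum passes to polynomial rings. -/
theorem PrimeSpectrum.noetherianSpace_polynomial (R : Type*) [CommRing R]
    [NoetherianSpace (PrimeSpectrum R)] : NoetherianSpace (PrimeSpectrum R[X]) := by
  suffices H : ∀ Z : Closeds (PrimeSpectrum R), ∀ t ⊆ comap (C : R →+* R[X]) ⁻¹' Z,
      IsCompact t by
    rw [noetherianSpace_iff_isCompact]
    exact fun t ↦ H ⊤ t fun _ _ ↦ trivial
  intro Z
  induction Z using WellFoundedLT.induction with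
  | _ Z ih =>
  rw [← noetherianSpace_set_iff, noetherianSpace_iff_opens]
  rintro ⟨_, hV⟩
  obtain ⟨U, hU, rfl⟩ := isOpen_induced_iff.mp hV
  rw [Opens.coe_mk, Topology.IsEmbedding.subtypeVal.isCompact_iff, Subtype.image_preimage_coe]
  obtain ⟨J, hJ⟩ := (isClosed_iff_zeroLocus_ideal _).mp hU.isClosed_compl
  have hUJ (x : PrimeSpectrum R[X]) : x ∈ U ↔ ¬ J ≤ x.asIdeal := by
    rw [← SetLike.coe_subset_coe, ← mem_zeroLocus, ← hJ, Set.mem_compl_iff, not_not]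
  set N := vanishingIdeal (Z : Set (PrimeSpectrum R)) with hN
  have hZN (x : PrimeSpectrum R[X]) : comap C x ∈ Z ↔ N.map C ≤ x.asIdeal := by
    rw [Ideal.map_le_iff_le_comap, ← comap_asIdeal, ← SetLike.coe_subset_coe (S := N),
      ← mem_zeroLocus, zeroLocus_vanishingIdeal_eq_closure, Z.isClosed.closure_eq]
    rfl
  by_cases hIN : J ⊔ N.map C ≤ N.map C
  · convert isCompact_empty
    rw [Set.eq_empty_iff_forall_notMem]
    rintro x ⟨hxZ, hxU⟩
    exact (hUJ x).mp hxU ((le_sup_left.trans hIN).trans ((hZN x).mp hxZ))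
  obtain ⟨f, hfI, hlc, hf⟩ := exists_leadingCoeff_notMem_forall_mem_of_mem le_sup_right hIN
  let W : Closeds (PrimeSpectrum R) :=
    ⟨Z ∩ zeroLocus {f.leadingCoeff}, Z.isClosed.inter (isClosed_zeroLocus _)⟩
  have hWZ : W < Z := by
    refine lt_of_le_of_ne (fun x hx ↦ hx.1) fun h ↦ hlc ?_
    rw [hN, mem_vanishingIdeal]
    intro x hx
    have : x ∈ W := h ▸ hx
    simpa using this.2
  have hsplit : comap (C : R →+* R[X]) ⁻¹' Z ∩ U =
      comap (C : R →+* R[X]) ⁻¹' Z ∩ basicOpen f ∪ comap (C : R →+* R[X]) ⁻¹' W ∩ U := by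
    ext x
    constructor
    · rintro ⟨hxZ, hxU⟩
      by_cases hfx : f ∈ x.asIdeal
      · refine .inr ⟨⟨hxZ, ?_⟩, hxU⟩
        by_contra hx
        refine (hUJ x).mp hxU (le_sup_left.trans (hf x.asIdeal x.2 ((hZN x).mp hxZ) hfx ?_))
        simpa using hx
      · exact .inl ⟨hxZ, hfx⟩
    · rintro (⟨hxZ, hfx⟩ | ⟨hxZ, hxU⟩)
      · exact ⟨hxZ, (hUJ x).mpr fun h ↦ hfx (sup_le h ((hZN x).mp hxZ) hfI)⟩
      · exact ⟨hxZ.1, hxU⟩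
  rw [hsplit]
  exact ((isCompact_basicOpen f).inter_left (Z.isClosed.preimage (continuous_comap C))).union
    (ih W hWZ _ Set.inter_subset_left)

open Polynomial in
/-- Finiteness of the Krull dimension passes to polynomial rings. -/
theorem Polynomial.ringKrullDim_lt_top {R : Type*} [CommRing R] (h : ringKrullDim R < ⊤) :
    ringKrullDim R[X] < ⊤ := by
  refine Polynomial.ringKrullDim_le.trans_lt ?_
  cases hd : ringKrullDim R with
  | bot => simp
  | coe d =>
    rw [hd] at h
    cases d with
    | top => exact absurd h (lt_irrefl _)
    | coe n =>
      have := WithBot.coe_lt_coe.mpr (ENat.natCast_lt_top (2 * n + 1))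
      push_cast at this
      exact this

/-- If the spectrum of `R` is Noetherian of finite dimension, so is that of `R[x₁, …, xₙ]`. -/
theorem MvPolynomial.noetherianSpace_and_ringKrullDim_lt_top {R : Type*} [CommRing R]
    [NoetherianSpace (PrimeSpectrum R)] (h : ringKrullDim R < ⊤) (n : ℕ) :
    NoetherianSpace (PrimeSpectrum (MvPolynomial (Fin n) R)) ∧
      ringKrullDim (MvPolynomial (Fin n) R) < ⊤ := by
  induction n with
  | zero =>
    let e := (MvPolynomial.isEmptyAlgEquiv R (Fin 0)).toRingEquiv
    exact ⟨(noetherianSpace_iff_of_homeomorph (PrimeSpectrum.homeomorphOfRingEquiv e)).mpr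
      inferInstance, (ringKrullDim_eq_of_ringEquiv e).trans_lt h⟩
  | succ n ih =>
    let e := (MvPolynomial.finSuccEquiv R n).toRingEquiv
    have := ih.1
    exact ⟨(noetherianSpace_iff_of_homeomorph (PrimeSpectrum.homeomorphOfRingEquiv e)).mpr
      (PrimeSpectrum.noetherianSpace_polynomial _),
      (ringKrullDim_eq_of_ringEquiv e).trans_lt (Polynomial.ringKrullDim_lt_top ih.2)⟩

/-- If the spectrum of `R` is Noetherian of finite dimension, so is that of any `R`-algebra of
finite type. -/
theorem RingHom.FiniteType.noetherianSpace_and_ringKrullDim_lt_top {R S : Type*} [CommRing R]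
    [CommRing S] {φ : R →+* S} (hφ : φ.FiniteType) [NoetherianSpace (PrimeSpectrum R)]
    (h : ringKrullDim R < ⊤) :
    NoetherianSpace (PrimeSpectrum S) ∧ ringKrullDim S < ⊤ := by
  algebraize [φ]
  obtain ⟨n, g, hg⟩ := Algebra.FiniteType.iff_quotient_mvPolynomial''.mp
    (inferInstance : Algebra.FiniteType R S)
  obtain ⟨hN, hd⟩ := MvPolynomial.noetherianSpace_and_ringKrullDim_lt_top h n
  have hemb := PrimeSpectrum.isClosedEmbedding_comap_of_surjective _ g.toRingHom hg
  exact ⟨hemb.isInducing.noetherianSpace,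
    (ringKrullDim_le_of_surjective g.toRingHom hg).trans_lt hd⟩

/-- A compact space which is locally Noetherian of finite dimension is Noetherian of finite
dimension. -/
theorem noetherianSpace_and_topologicalKrullDim_lt_top_of_forall_exists_open {T : Type*}
    [TopologicalSpace T] [CompactSpace T]
    (h : ∀ y : T, ∃ V : Opens T, y ∈ V ∧ NoetherianSpace V ∧ topologicalKrullDim V < ⊤) :
    NoetherianSpace T ∧ topologicalKrullDim T < ⊤ := by
  choose V hyV hV hd using h
  obtain ⟨t, ht⟩ := CompactSpace.elim_nhds_subcover (fun y ↦ (V y : Set T))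
    fun y ↦ (V y).isOpen.mem_nhds (hyV y)
  constructor
  · have hcover : ⋃ y : t, (V y : Set T) = Set.univ := by
      rw [← Set.top_eq_univ, ← ht, Set.iUnion_subtype]
    have (y : t) : NoetherianSpace (V y : Set T) := hV y
    rw [← noetherian_univ_iff, ← hcover]
    exact NoetherianSpace.iUnion (fun y : t ↦ (V y : Set T))
  · have hsup : t.sup (fun y ↦ topologicalKrullDim (V y)) < ⊤ :=
      (Finset.sup_lt_iff bot_lt_top).mpr fun y _ ↦ hd y
    refine lt_of_le_of_lt ?_ hsup
    rw [topologicalKrullDim, Order.krullDim_eq_iSup_coheight, iSup_le_iff]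
    intro Z
    obtain ⟨z, hz⟩ := Z.isIrreducible.nonempty
    obtain ⟨y, hyt, hzy⟩ : ∃ y ∈ t, z ∈ V y := by
      simpa using ht.ge (Set.mem_univ z)
    have hemb := (V y).isOpenEmbedding'
    obtain ⟨W, hW⟩ := (IrreducibleCloseds.orderIsoOfIsOpenEmbedding _ hemb).surjective
      ⟨Z, ⟨⟨z, hzy⟩, hz⟩⟩
    have hWZ : IrreducibleCloseds.map _ hemb.continuous W = Z := congrArg Subtype.val hW
    rw [← hWZ, hemb.coheight_map]
    exact (Order.coheight_le_krullDim W).trans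
      (Finset.le_sup (f := fun y ↦ topologicalKrullDim (V y)) hyt)

/-- If `X` is a scheme whose underlying topological space is Noetherian of finite
Krull dimension and `Y ⟶ X` is a morphism of finite type (quasi-compact and locally
of finite type), then the underlying topological space of `Y` is Noetherian and of
finite dimension. -/
theorem stmt_19 {Y X : Scheme} (f : Y ⟶ X)
    [NoetherianSpace X] (hdim : topologicalKrullDim X < ⊤)
    [LocallyOfFiniteType f] [QuasiCompact f] :
    NoetherianSpace Y ∧ topologicalKrullDim Y < ⊤ := by
  have : CompactSpace Y := QuasiCompact.compactSpace_of_compactSpace f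
  refine noetherianSpace_and_topologicalKrullDim_lt_top_of_forall_exists_open fun y ↦ ?_
  obtain ⟨U, hU, hyU, -⟩ := exists_isAffineOpen_mem_and_subset (U := ⊤) (x := f y) trivial
  obtain ⟨V, hV, hyV, hVU⟩ := exists_isAffineOpen_mem_and_subset (U := f ⁻¹ᵁ U) (x := y) hyU
  let eU : U ≃ₜ PrimeSpectrum Γ(X, U) := hU.isoSpec.hom.homeomorph
  let eV : V ≃ₜ PrimeSpectrum Γ(Y, V) := hV.isoSpec.hom.homeomorph
  have : NoetherianSpace (PrimeSpectrum Γ(X, U)) :=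
    (noetherianSpace_iff_of_homeomorph eU).mp (NoetherianSpace.set (U : Set X))
  have hd : ringKrullDim Γ(X, U) < ⊤ := by
    rw [← PrimeSpectrum.topologicalKrullDim_eq_ringKrullDim,
      ← IsHomeomorph.topologicalKrullDim_eq _ eU.isHomeomorph]
    exact (topologicalKrullDim_subspace_le X U).trans_lt hdim
  obtain ⟨hN, hdV⟩ :=
    (f.finiteType_appLE hU hV hVU).noetherianSpace_and_ringKrullDim_lt_top hd
  refine ⟨V, hyV, (noetherianSpace_iff_of_homeomorph eV).mpr hN, ?_⟩
  exact ((IsHomeomorph.topologicalKrullDim_eq _ eV.isHomeomorph).trans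
    (PrimeSpectrum.topologicalKrullDim_eq_ringKrullDim _)).trans_lt hdV
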